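/- In the attack-free case, i.e., when the attack channel P_{Z|Y} is the identity (Z = Y), the achievable region of Theorem 3 coincides with that of Theorem 2: a quintuple (D, D', R_c, h, h') satisfies the conditions of Theorem 3 for some random variables (V, Y) with P_{KXVYZ} = P_X P_K P_{VY|KX} P_{Z|Y} if and only if it satisfies the conditions of Theorem 2; in particular, choosing V = Y with (V, Y) independent of K simultaneously turns all the inequalities H(K|Y) ≤ H(K), I(V;Y|K) − I(V;X|K) ≤ H(Y|X), and I(X;Y,V|K) + I(K;Y) ≥ I(X;Y) into equalities. -/

import Mathlib

open Finset

noncomputable section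

namespace JWE

variable {Ω α β γ : Type*}

/-- Probability that the random variable `f` takes the value `a`, under the pmf `μ`. -/
def prEq [Fintype Ω] [DecidableEq α] (μ : Ω → ℝ) (f : Ω → α) (a : α) : ℝ :=
  ∑ ω, if f ω = a then μ ω else 0

/-- `μ` is a probability mass function on the finite type `Ω`. -/
def IsPMF [Fintype Ω] (μ : Ω → ℝ) : Prop :=
  (∀ ω, 0 ≤ μ ω) ∧ ∑ ω, μ ω = 1

/-- Shannon entropy (in bits) of the random variable `f` under `μ`. -/
def ent [Fintype Ω] [Fintype α] [DecidableEq α] (μ : Ω → ℝ) (f : Ω → α) : ℝ :=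
  -∑ a, prEq μ f a * Real.logb 2 (prEq μ f a)

/-- Shannon entropy (in bits) of a pmf `p` on a finite alphabet. -/
def entPMF [Fintype α] (p : α → ℝ) : ℝ :=
  -∑ a, p a * Real.logb 2 (p a)

/-- Conditional entropy H(f | g) under `μ`. -/
def condEnt [Fintype Ω] [Fintype α] [DecidableEq α] [Fintype β] [DecidableEq β]
    (μ : Ω → ℝ) (f : Ω → α) (g : Ω → β) : ℝ :=
  ent μ (fun ω => (f ω, g ω)) - ent μ g

/-- Mutual information I(f ; g) under `μ`. -/
def mutInf [Fintype Ω] [Fintype α] [DecidableEq α] [Fintype β] [DecidableEq β]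
    (μ : Ω → ℝ) (f : Ω → α) (g : Ω → β) : ℝ :=
  ent μ f + ent μ g - ent μ (fun ω => (f ω, g ω))

/-- Conditional mutual information I(f ; g | h) under `μ`. -/
def condMutInf [Fintype Ω] [Fintype α] [DecidableEq α] [Fintype β] [DecidableEq β]
    [Fintype γ] [DecidableEq γ] (μ : Ω → ℝ) (f : Ω → α) (g : Ω → β) (h : Ω → γ) : ℝ :=
  condEnt μ f h - condEnt μ f (fun ω => (g ω, h ω))

/-- Expected distortion E d(f, g) under `μ`. -/
def expDist [Fintype Ω] (μ : Ω → ℝ) (d : α → β → ℝ) (f : Ω → α) (g : Ω → β) : ℝ :=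
  ∑ ω, μ ω * d (f ω) (g ω)

/-- `W` is a channel (conditional pmf) from `α` to `β`. -/
def IsChannel [Fintype β] (W : α → β → ℝ) : Prop :=
  (∀ a b, 0 ≤ W a b) ∧ ∀ a, ∑ b, W a b = 1

/-- `f` and `g` are independent under `μ`. -/
def IndepRV [Fintype Ω] [DecidableEq α] [DecidableEq β]
    (μ : Ω → ℝ) (f : Ω → α) (g : Ω → β) : Prop :=
  ∀ a b, prEq μ (fun ω => (f ω, g ω)) (a, b) = prEq μ f a * prEq μ g b

/-- `f` and `g` are conditionally independent given `h` under `μ`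
(equivalently, `f → h → g` is a Markov chain). -/
def CondIndep [Fintype Ω] [DecidableEq α] [DecidableEq β] [DecidableEq γ]
    (μ : Ω → ℝ) (f : Ω → α) (g : Ω → β) (h : Ω → γ) : Prop :=
  ∀ a b c, prEq μ (fun ω => ((f ω, g ω), h ω)) ((a, b), c) * prEq μ h c =
    prEq μ (fun ω => (f ω, h ω)) (a, c) * prEq μ (fun ω => (g ω, h ω)) (b, c)

/-- The coordinates of the random vector `f` are i.i.d. with single-letter law `q`. -/
def IIDWithLaw [Fintype Ω] [DecidableEq α] {n : ℕ}
    (μ : Ω → ℝ) (f : Ω → Fin n → α) (q : α → ℝ) : Prop :=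
  ∀ v : Fin n → α, prEq μ f v = ∏ t, q (v t)

/-- Rate–distortion function of the source `pU` with respect to the distortion measure `d'`. -/
def RU {U Uh : Type*} [Fintype U] [DecidableEq U] [Fintype Uh] [DecidableEq Uh]
    (pU : U → ℝ) (d' : U → Uh → ℝ) (D' : ℝ) : ℝ :=
  sInf { r : ℝ | ∃ W : U → Uh → ℝ, IsChannel W ∧
    (∑ u, ∑ uh, pU u * W u uh * d' u uh) ≤ D' ∧
    r = mutInf (fun p : U × Uh => pU p.1 * W p.1 p.2) Prod.fst Prod.snd }

end JWE

open JWE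

section Statement19

variable {𝒰 𝒰h 𝒳 𝒦 𝒴 : Type*}
  [Fintype 𝒰] [DecidableEq 𝒰] [Fintype 𝒰h] [DecidableEq 𝒰h]
  [Fintype 𝒳] [DecidableEq 𝒳] [Fintype 𝒦] [DecidableEq 𝒦]
  [Fintype 𝒴] [DecidableEq 𝒴]

/-- Single-letter joint pmf of `(X, Y)` induced by the covertext law `pX` and a channel `W`. -/
def jm (pX : 𝒳 → ℝ) (W : 𝒳 → 𝒴 → ℝ) : 𝒳 × 𝒴 → ℝ :=
  fun p => pX p.1 * W p.1 p.2

/-- The conditions of Theorem 2 on the quintuple `(D, D', R_c, h, h')`. -/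
def Thm2Conds (pU : 𝒰 → ℝ) (pK : 𝒦 → ℝ) (pX : 𝒳 → ℝ)
    (d : 𝒳 → 𝒴 → ℝ) (d' : 𝒰 → 𝒰h → ℝ) (lam D D' Rc h h' : ℝ) : Prop :=
  h ≤ entPMF pK / lam + entPMF pU - RU pU d' D' ∧
  h' ≤ entPMF pK / lam ∧
  ∃ W : 𝒳 → 𝒴 → ℝ, IsChannel W ∧
    lam * RU pU d' D' ≤ condEnt (jm pX W) Prod.snd Prod.fst ∧
    Rc ≥ lam * RU pU d' D' + mutInf (jm pX W) Prod.fst Prod.snd ∧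
    D ≥ expDist (jm pX W) d Prod.fst Prod.snd

/-- Joint single-letter pmf of `(K, X, V, Y, Z)` in the attack-free case (the attack
channel is the identity, i.e. `Z = Y`), with law P_K P_X P_{VY|KX} 1{z = y}. -/
def jointAF {𝒱 : Type*} (pK : 𝒦 → ℝ) (pX : 𝒳 → ℝ) (W : 𝒦 → 𝒳 → 𝒱 → 𝒴 → ℝ) :
    (𝒦 × 𝒳 × 𝒱 × 𝒴 × 𝒴) → ℝ :=
  fun ω => pK ω.1 * pX ω.2.1 * W ω.1 ω.2.1 ω.2.2.1 ω.2.2.2.1 *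
    (if ω.2.2.2.2 = ω.2.2.2.1 then 1 else 0)

/-- The conditions of Theorem 3 on `(D, D', R_c, h, h')` specialized to the attack-free
case `Z = Y`. -/
def Thm3CondsAF (pU : 𝒰 → ℝ) (pK : 𝒦 → ℝ) (pX : 𝒳 → ℝ)
    (d : 𝒳 → 𝒴 → ℝ) (d' : 𝒰 → 𝒰h → ℝ) (lam D D' Rc h h' : ℝ) : Prop :=
  ∃ m : ℕ, m ≤ Fintype.card 𝒦 * Fintype.card 𝒳 * Fintype.card 𝒴 + 1 ∧
  ∃ W : 𝒦 → 𝒳 → Fin m → 𝒴 → ℝ,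
    (∀ k x v y, 0 ≤ W k x v y) ∧ (∀ k x, ∑ v, ∑ y, W k x v y = 1) ∧
    -- (a)
    h ≤ condEnt (jointAF pK pX W) (fun ω => ω.1) (fun ω => ω.2.2.2.1) / lam
      + entPMF pU - RU pU d' D' ∧
    -- (b)
    h' ≤ condEnt (jointAF pK pX W) (fun ω => ω.1) (fun ω => ω.2.2.2.1) / lam ∧
    -- (c)
    lam * RU pU d' D' ≤
      condMutInf (jointAF pK pX W) (fun ω => ω.2.2.1) (fun ω => ω.2.2.2.2) (fun ω => ω.1)
      - condMutInf (jointAF pK pX W) (fun ω => ω.2.2.1) (fun ω => ω.2.1) (fun ω => ω.1) ∧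
    -- (d)
    Rc ≥ lam * RU pU d' D'
      + condMutInf (jointAF pK pX W) (fun ω => ω.2.1) (fun ω => (ω.2.2.2.1, ω.2.2.1))
          (fun ω => ω.1)
      + mutInf (jointAF pK pX W) (fun ω => ω.1) (fun ω => ω.2.2.2.1) ∧
    -- (e)
    D ≥ expDist (jointAF pK pX W) d (fun ω => ω.2.1) (fun ω => ω.2.2.2.1)

end Statement19

namespace JWE

section Entropy

variable {Ω α β γ : Type*} [Fintype Ω] [Fintype α] [DecidableEq α] [Fintype β] [DecidableEq β]
  [Fintype γ] [DecidableEq γ] {μ : Ω → ℝ}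

theorem sum_mul_comp (μ : Ω → ℝ) (f : Ω → α) (F : α → ℝ) :
    ∑ ω, μ ω * F (f ω) = ∑ a, prEq μ f a * F a := by
  simp only [prEq, Finset.sum_mul]
  rw [Finset.sum_comm]
  refine Finset.sum_congr rfl fun ω _ => ?_
  simp [ite_mul]

omit [Fintype α] in
theorem prEq_nonneg (hμ : ∀ ω, 0 ≤ μ ω) (f : Ω → α) (a : α) : 0 ≤ prEq μ f a :=
  Finset.sum_nonneg fun ω _ => by split_ifs <;> simp [hμ]

omit [Fintype α] in
theorem le_prEq_apply (hμ : ∀ ω, 0 ≤ μ ω) (f : Ω → α) (ω : Ω) : μ ω ≤ prEq μ f (f ω) := by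
  have h := Finset.single_le_sum (f := fun ω' => if f ω' = f ω then μ ω' else 0)
    (fun ω' _ => by split_ifs <;> simp [hμ]) (Finset.mem_univ ω)
  simpa [prEq] using h

omit [Fintype α] in
theorem prEq_apply_pos (hμ : ∀ ω, 0 ≤ μ ω) (f : Ω → α) {ω : Ω} (h : μ ω ≠ 0) :
    0 < prEq μ f (f ω) :=
  ((hμ ω).lt_of_ne' h).trans_le (le_prEq_apply hμ f ω)

theorem sum_prEq (μ : Ω → ℝ) (f : Ω → α) : ∑ a, prEq μ f a = ∑ ω, μ ω := by
  simpa using (sum_mul_comp μ f fun _ => 1).symm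

theorem IsPMF.card_pos (hμ : IsPMF μ) : 0 < Fintype.card Ω := by
  refine Fintype.card_pos_iff.2 (not_isEmpty_iff.1 fun h => ?_)
  simpa using hμ.2

omit [Fintype β] in
/-- The law of `φ ∘ f` is the image under `φ` of the law of `f`. -/
theorem prEq_prEq (μ : Ω → ℝ) (f : Ω → α) (φ : α → β) (b : β) :
    prEq (prEq μ f) φ b = prEq μ (fun ω => φ (f ω)) b := by
  have h := sum_mul_comp μ f fun a => if φ a = b then 1 else 0
  simpa [prEq] using h.symm

omit [Fintype β] in
theorem sum_prEq_prod_left (μ : Ω → ℝ) (f : Ω → α) (g : Ω → β) (b : β) :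
    ∑ a, prEq μ (fun ω => (f ω, g ω)) (a, b) = prEq μ g b := by
  simp only [prEq, Prod.mk.injEq]
  rw [Finset.sum_comm]
  refine Finset.sum_congr rfl fun ω _ => ?_
  by_cases h : g ω = b <;> simp [h]

theorem ent_eq_neg_sum (μ : Ω → ℝ) (f : Ω → α) :
    ent μ f = -∑ ω, μ ω * Real.logb 2 (prEq μ f (f ω)) := by
  rw [ent, sum_mul_comp μ f fun a => Real.logb 2 (prEq μ f a)]

theorem ent_prEq (μ : Ω → ℝ) (φ : Ω → α) (f : α → β) :
    ent (prEq μ φ) f = ent μ (fun ω => f (φ ω)) := by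
  simp only [ent, prEq_prEq]

/-- If `f` is a function of `g` on the support of `μ`, then `H(f) ≤ H(g)`. -/
theorem ent_le_ent (hμ : ∀ ω, 0 ≤ μ ω) {f : Ω → α} {g : Ω → β}
    (h : ∀ ω ω', μ ω ≠ 0 → μ ω' ≠ 0 → g ω = g ω' → f ω = f ω') : ent μ f ≤ ent μ g := by
  rw [ent_eq_neg_sum, ent_eq_neg_sum, neg_le_neg_iff]
  refine Finset.sum_le_sum fun ω _ => ?_
  by_cases h0 : μ ω = 0
  · simp [h0]
  refine mul_le_mul_of_nonneg_left ?_ (hμ ω)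
  refine Real.logb_le_logb_of_le one_lt_two (prEq_apply_pos hμ g h0) ?_
  refine Finset.sum_le_sum fun ω' _ => ?_
  by_cases h1 : μ ω' = 0
  · simp [h1]
  by_cases h2 : g ω' = g ω
  · simp [h2, h ω' ω h1 h0 h2]
  · simp only [h2, if_false]
    split_ifs <;> simp [hμ]

theorem ent_eq_ent (hμ : ∀ ω, 0 ≤ μ ω) {f : Ω → α} {g : Ω → β}
    (h : ∀ ω ω', μ ω ≠ 0 → μ ω' ≠ 0 → (f ω = f ω' ↔ g ω = g ω')) : ent μ f = ent μ g :=
  le_antisymm (ent_le_ent hμ fun ω ω' h0 h1 => (h ω ω' h0 h1).2)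
    (ent_le_ent hμ fun ω ω' h0 h1 => (h ω ω' h0 h1).1)

/-- Submodularity of entropy, i.e. nonnegativity of `I(f ; g | h)`. -/
theorem ent_submodular (hμ : ∀ ω, 0 ≤ μ ω) (f : Ω → α) (g : Ω → β) (h : Ω → γ) :
    ent μ (fun ω => (f ω, g ω, h ω)) + ent μ h ≤
      ent μ (fun ω => (f ω, h ω)) + ent μ (fun ω => (g ω, h ω)) := by
  set p := prEq μ (fun ω => (f ω, g ω, h ω)) with hp
  set pf := prEq μ (fun ω => (f ω, h ω)) with hpf
  set pg := prEq μ (fun ω => (g ω, h ω)) with hpg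
  set ph := prEq μ h with hph
  have hpf0 : ∀ a, 0 ≤ pf a := prEq_nonneg hμ _
  have hpg0 : ∀ a, 0 ≤ pg a := prEq_nonneg hμ _
  have hph0 : ∀ a, 0 ≤ ph a := prEq_nonneg hμ _
  let F : α × β × γ → ℝ := fun t => pf (t.1, t.2.2) * pg (t.2.1, t.2.2) / (p t * ph t.2.2)
  have hF : ∑ ω, μ ω * F (f ω, g ω, h ω) ≤ ∑ ω, μ ω := by
    rw [sum_mul_comp μ (fun ω => (f ω, g ω, h ω)) F, ← hp]
    calc ∑ t, p t * F t
        ≤ ∑ t : α × β × γ, pf (t.1, t.2.2) * pg (t.2.1, t.2.2) / ph t.2.2 := by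
          refine Finset.sum_le_sum fun t _ => ?_
          by_cases h0 : p t = 0
          · rw [h0, zero_mul]
            exact div_nonneg (mul_nonneg (hpf0 _) (hpg0 _)) (hph0 _)
          · refine le_of_eq ?_
            simp only [F]
            rw [← mul_div_assoc, mul_div_mul_left _ _ h0]
      _ = ∑ c, (∑ a, pf (a, c)) * (∑ b, pg (b, c)) / ph c := by
          simp only [Fintype.sum_prod_type, Finset.sum_mul_sum, Finset.sum_div]
          rw [Finset.sum_congr rfl fun a _ => Finset.sum_comm]
          rw [Finset.sum_comm]
      _ = ∑ c, ph c := by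
          refine Finset.sum_congr rfl fun c _ => ?_
          rw [hpf, hpg, sum_prEq_prod_left, sum_prEq_prod_left, ← hph, mul_self_div_self]
      _ = ∑ ω, μ ω := sum_prEq μ h
  have hlog : ∀ ω, μ ω * (Real.logb 2 (pf (f ω, h ω)) + Real.logb 2 (pg (g ω, h ω))
      - Real.logb 2 (p (f ω, g ω, h ω)) - Real.logb 2 (ph (h ω))) ≤
      (μ ω * F (f ω, g ω, h ω) - μ ω) / Real.log 2 := by
    intro ω
    by_cases h0 : μ ω = 0
    · simp [h0]
    have h1 : 0 < p (f ω, g ω, h ω) := prEq_apply_pos hμ (fun ω => (f ω, g ω, h ω)) h0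
    have h2 : 0 < pf (f ω, h ω) := prEq_apply_pos hμ (fun ω => (f ω, h ω)) h0
    have h3 : 0 < pg (g ω, h ω) := prEq_apply_pos hμ (fun ω => (g ω, h ω)) h0
    have h4 : 0 < ph (h ω) := prEq_apply_pos hμ h h0
    have h5 : 0 < F (f ω, g ω, h ω) := div_pos (mul_pos h2 h3) (mul_pos h1 h4)
    have h6 := Real.log_le_sub_one_of_pos h5
    have h7 : Real.log (F (f ω, g ω, h ω)) = Real.log (pf (f ω, h ω)) + Real.log (pg (g ω, h ω))
        - Real.log (p (f ω, g ω, h ω)) - Real.log (ph (h ω)) := by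
      simp only [F]
      rw [Real.log_div (mul_pos h2 h3).ne' (mul_pos h1 h4).ne', Real.log_mul h2.ne' h3.ne',
        Real.log_mul h1.ne' h4.ne']
      ring
    rw [h7] at h6
    simp only [Real.logb]
    rw [← add_div, ← sub_div, ← sub_div, ← mul_div_assoc]
    refine div_le_div_of_nonneg_right ?_ (Real.log_pos one_lt_two).le
    calc _ ≤ μ ω * (F (f ω, g ω, h ω) - 1) := mul_le_mul_of_nonneg_left h6 (hμ ω)
      _ = _ := by ring
  have hsum := Finset.sum_le_sum fun ω (_ : ω ∈ Finset.univ) => hlog ω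
  rw [← Finset.sum_div, Finset.sum_sub_distrib] at hsum
  have hneg : (∑ ω, μ ω * F (f ω, g ω, h ω) - ∑ ω, μ ω) / Real.log 2 ≤ 0 :=
    div_nonpos_of_nonpos_of_nonneg (by linarith) (Real.log_pos one_lt_two).le
  simp only [mul_sub, mul_add, Finset.sum_sub_distrib, Finset.sum_add_distrib] at hsum
  simp only [ent_eq_neg_sum, ← hp, ← hpf, ← hpg, ← hph]
  linarith

theorem ent_pair_le (hμ : IsPMF μ) (f : Ω → α) (g : Ω → β) :
    ent μ (fun ω => (f ω, g ω)) ≤ ent μ f + ent μ g := by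
  have h := ent_submodular hμ.1 f g fun _ => ()
  have h0 : ent μ (fun _ => ()) = 0 := by simp [ent, prEq, hμ.2]
  have h1 : ent μ (fun ω => (f ω, g ω, ())) = ent μ (fun ω => (f ω, g ω)) :=
    ent_eq_ent hμ.1 (by simp)
  have h2 : ent μ (fun ω => (f ω, ())) = ent μ f := ent_eq_ent hμ.1 (by simp)
  have h3 : ent μ (fun ω => (g ω, ())) = ent μ g := ent_eq_ent hμ.1 (by simp)
  linarith

theorem ent_pair_of_indepRV (hμ : IsPMF μ) {f : Ω → α} {g : Ω → β} (hfg : IndepRV μ f g) :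
    ent μ (fun ω => (f ω, g ω)) = ent μ f + ent μ g := by
  simp only [ent_eq_neg_sum]
  rw [← neg_add, ← Finset.sum_add_distrib]
  congr 1
  refine Finset.sum_congr rfl fun ω _ => ?_
  by_cases h0 : μ ω = 0
  · simp [h0]
  rw [hfg, Real.logb_mul (prEq_apply_pos hμ.1 f h0).ne' (prEq_apply_pos hμ.1 g h0).ne', mul_add]

theorem expDist_prEq_pair (μ : Ω → ℝ) (d : α → β → ℝ) (f : Ω → α) (g : Ω → β) :
    expDist (prEq μ fun ω => (f ω, g ω)) d Prod.fst Prod.snd = expDist μ d f g :=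
  (sum_mul_comp μ (fun ω => (f ω, g ω)) fun p => d p.1 p.2).symm

end Entropy

end JWE

section AttackFree

variable {𝒳 𝒦 𝒱 𝒴 : Type*} [Fintype 𝒳] [DecidableEq 𝒳] [Fintype 𝒦] [DecidableEq 𝒦]
  [Fintype 𝒱] [DecidableEq 𝒱] [Fintype 𝒴] [DecidableEq 𝒴]
  {pK : 𝒦 → ℝ} {pX : 𝒳 → ℝ}

omit [DecidableEq 𝒳] [DecidableEq 𝒦] [DecidableEq 𝒱] in
theorem isPMF_jointAF (hpK : IsPMF pK) (hpX : IsPMF pX) {W : 𝒦 → 𝒳 → 𝒱 → 𝒴 → ℝ}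
    (hW : ∀ k x v y, 0 ≤ W k x v y) (hW1 : ∀ k x, ∑ v, ∑ y, W k x v y = 1) :
    IsPMF (jointAF pK pX W) := by
  refine ⟨fun ω => mul_nonneg (mul_nonneg (mul_nonneg (hpK.1 _) (hpX.1 _)) (hW _ _ _ _))
    (by split_ifs <;> simp), ?_⟩
  simp only [jointAF, Fintype.sum_prod_type, mul_ite, mul_one, mul_zero, Finset.sum_ite_eq',
    Finset.mem_univ, if_true, ← Finset.mul_sum, hW1, hpX.2, hpK.2]

omit [Fintype 𝒳] [DecidableEq 𝒳] [Fintype 𝒦] [DecidableEq 𝒦] [Fintype 𝒱] [DecidableEq 𝒱]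
  [Fintype 𝒴] in
theorem eq_of_jointAF_ne_zero {W : 𝒦 → 𝒳 → 𝒱 → 𝒴 → ℝ} {ω : 𝒦 × 𝒳 × 𝒱 × 𝒴 × 𝒴}
    (h : jointAF pK pX W ω ≠ 0) : ω.2.2.2.2 = ω.2.2.2.1 := by
  by_contra h0
  simp [jointAF, h0] at h

omit [DecidableEq 𝒱] in
theorem prEq_jointAF (W : 𝒦 → 𝒳 → 𝒱 → 𝒴 → ℝ) (k : 𝒦) (x : 𝒳) (y : 𝒴) :
    prEq (jointAF pK pX W) (fun ω => (ω.1, ω.2.1, ω.2.2.2.1)) (k, x, y) =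
      pK k * pX x * ∑ v, W k x v y := by
  simp only [prEq, jointAF, Fintype.sum_prod_type, Prod.mk.injEq, ite_and, mul_ite, mul_one,
    mul_zero]
  simp [Finset.mul_sum]

/-- The channel from `X` to `Y` obtained by averaging out the key and the auxiliary variable. -/
def averagedChannel (pK : 𝒦 → ℝ) (W : 𝒦 → 𝒳 → 𝒱 → 𝒴 → ℝ) (x : 𝒳) (y : 𝒴) : ℝ :=
  ∑ k, pK k * ∑ v, W k x v y

omit [Fintype 𝒳] [DecidableEq 𝒳] [DecidableEq 𝒦] [DecidableEq 𝒱] [DecidableEq 𝒴] in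
theorem isChannel_averagedChannel (hpK : IsPMF pK) {W : 𝒦 → 𝒳 → 𝒱 → 𝒴 → ℝ}
    (hW : ∀ k x v y, 0 ≤ W k x v y) (hW1 : ∀ k x, ∑ v, ∑ y, W k x v y = 1) :
    IsChannel (averagedChannel pK W) := by
  refine ⟨fun x y => Finset.sum_nonneg fun k _ => mul_nonneg (hpK.1 k)
    (Finset.sum_nonneg fun v _ => hW k x v y), fun x => ?_⟩
  simp only [averagedChannel]
  rw [Finset.sum_comm]
  simp only [← Finset.mul_sum]
  rw [Finset.sum_congr rfl fun k _ => by rw [Finset.sum_comm, hW1, mul_one], hpK.2]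

omit [DecidableEq 𝒱] in
theorem jm_averagedChannel (W : 𝒦 → 𝒳 → 𝒱 → 𝒴 → ℝ) :
    jm pX (averagedChannel pK W) =
      prEq (jointAF pK pX W) (fun ω => (ω.2.1, ω.2.2.2.1)) := by
  funext ⟨x, y⟩
  rw [← sum_prEq_prod_left _ (fun ω => ω.1)]
  simp only [prEq_jointAF, jm, averagedChannel, Finset.mul_sum]
  exact Finset.sum_congr rfl fun k _ => Finset.sum_congr rfl fun v _ => by ring

omit [DecidableEq 𝒱] in
theorem prEq_jointAF_key (hpX : IsPMF pX) {W : 𝒦 → 𝒳 → 𝒱 → 𝒴 → ℝ}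
    (hW1 : ∀ k x, ∑ v, ∑ y, W k x v y = 1) :
    prEq (jointAF pK pX W) (fun ω => ω.1) = pK := by
  funext k
  have h := prEq_prEq (jointAF pK pX W) (fun ω => (ω.1, ω.2.1, ω.2.2.2.1)) Prod.fst k
  rw [← h, prEq, Fintype.sum_prod_type]
  simp only [Finset.sum_ite_irrel, Finset.sum_const_zero, Finset.sum_ite_eq', Finset.mem_univ,
    if_true, Fintype.sum_prod_type, prEq_jointAF, ← Finset.mul_sum]
  rw [Finset.sum_congr rfl fun x _ => by rw [Finset.sum_comm, hW1, mul_one], ← Finset.mul_sum,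
    hpX.2, mul_one]

omit [DecidableEq 𝒱] in
theorem ent_jointAF_key (hpX : IsPMF pX) {W : 𝒦 → 𝒳 → 𝒱 → 𝒴 → ℝ}
    (hW1 : ∀ k x, ∑ v, ∑ y, W k x v y = 1) :
    ent (jointAF pK pX W) (fun ω => ω.1) = entPMF pK := by
  rw [ent, prEq_jointAF_key hpX hW1, entPMF]

omit [DecidableEq 𝒱] in
theorem condEnt_key_le (hpK : IsPMF pK) (hpX : IsPMF pX) {W : 𝒦 → 𝒳 → 𝒱 → 𝒴 → ℝ}
    (hW : ∀ k x v y, 0 ≤ W k x v y) (hW1 : ∀ k x, ∑ v, ∑ y, W k x v y = 1) :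
    condEnt (jointAF pK pX W) (fun ω => ω.1) (fun ω => ω.2.2.2.1) ≤ entPMF pK := by
  have h := ent_pair_le (isPMF_jointAF hpK hpX hW hW1) (fun ω => ω.1) (fun ω => ω.2.2.2.1)
  rw [ent_jointAF_key hpX hW1] at h
  rw [condEnt]
  linarith

/-- `I(V;Z|K) − I(V;X|K) ≤ H(Y|X)`. -/
theorem condMutInf_sub_condMutInf_le (hpK : IsPMF pK) (hpX : IsPMF pX)
    {W : 𝒦 → 𝒳 → 𝒱 → 𝒴 → ℝ}
    (hW : ∀ k x v y, 0 ≤ W k x v y) (hW1 : ∀ k x, ∑ v, ∑ y, W k x v y = 1) :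
    condMutInf (jointAF pK pX W) (fun ω => ω.2.2.1) (fun ω => ω.2.2.2.2) (fun ω => ω.1)
      - condMutInf (jointAF pK pX W) (fun ω => ω.2.2.1) (fun ω => ω.2.1) (fun ω => ω.1)
      ≤ condEnt (jm pX (averagedChannel pK W)) Prod.snd Prod.fst := by
  have hμ := (isPMF_jointAF hpK hpX hW hW1).1
  rw [jm_averagedChannel]
  simp only [condMutInf, condEnt, ent_prEq]
  set μ := jointAF pK pX W
  have h1 := ent_submodular hμ (fun ω => ω.2.2.1) (fun ω => ω.2.1) (fun ω => (ω.2.2.2.1, ω.1))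
  have h2 := ent_submodular hμ (fun ω => ω.2.2.2.1) (fun ω => ω.1) (fun ω => ω.2.1)
  have h3 : ent μ (fun ω => (ω.2.2.1, ω.2.1, ω.1)) ≤
      ent μ (fun ω => (ω.2.2.1, ω.2.1, ω.2.2.2.1, ω.1)) := ent_le_ent hμ (by simp +contextual)
  have h4 : ent μ (fun ω => (ω.2.2.1, ω.2.2.2.2, ω.1)) =
      ent μ (fun ω => (ω.2.2.1, ω.2.2.2.1, ω.1)) := ent_eq_ent hμ fun ω ω' h h' => by
    rw [eq_of_jointAF_ne_zero h, eq_of_jointAF_ne_zero h']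
  have h5 : ent μ (fun ω => (ω.2.2.2.2, ω.1)) = ent μ (fun ω => (ω.2.2.2.1, ω.1)) :=
    ent_eq_ent hμ fun ω ω' h h' => by
      rw [eq_of_jointAF_ne_zero h, eq_of_jointAF_ne_zero h']
  have h6 : ent μ (fun ω => (ω.2.2.2.1, ω.1, ω.2.1)) = ent μ (fun ω => (ω.2.1, ω.2.2.2.1, ω.1)) :=
    ent_eq_ent hμ (by grind)
  have h7 : ent μ (fun ω => (ω.1, ω.2.1)) = ent μ (fun ω => (ω.2.1, ω.1)) :=
    ent_eq_ent hμ (by grind)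
  linarith

/-- `I(X;Y) ≤ I(X;Y,V|K) + I(K;Y)`. -/
theorem mutInf_le_condMutInf_add_mutInf (hpK : IsPMF pK) (hpX : IsPMF pX)
    {W : 𝒦 → 𝒳 → 𝒱 → 𝒴 → ℝ}
    (hW : ∀ k x v y, 0 ≤ W k x v y) (hW1 : ∀ k x, ∑ v, ∑ y, W k x v y = 1) :
    mutInf (jm pX (averagedChannel pK W)) Prod.fst Prod.snd ≤
      condMutInf (jointAF pK pX W) (fun ω => ω.2.1) (fun ω => (ω.2.2.2.1, ω.2.2.1)) (fun ω => ω.1)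
        + mutInf (jointAF pK pX W) (fun ω => ω.1) (fun ω => ω.2.2.2.1) := by
  have hμ := (isPMF_jointAF hpK hpX hW hW1).1
  rw [jm_averagedChannel]
  simp only [condMutInf, condEnt, mutInf, ent_prEq]
  set μ := jointAF pK pX W
  have h1 := ent_submodular hμ (fun ω => ω.2.1) (fun ω => ω.2.2.1) (fun ω => (ω.2.2.2.1, ω.1))
  have h2 := ent_submodular hμ (fun ω => ω.2.2.2.1) (fun ω => ω.1) (fun ω => ω.2.1)
  have h3 : ent μ (fun ω => (ω.2.1, (ω.2.2.2.1, ω.2.2.1), ω.1)) =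
      ent μ (fun ω => (ω.2.1, ω.2.2.1, ω.2.2.2.1, ω.1)) := ent_eq_ent hμ (by grind)
  have h4 : ent μ (fun ω => ((ω.2.2.2.1, ω.2.2.1), ω.1)) =
      ent μ (fun ω => (ω.2.2.1, ω.2.2.2.1, ω.1)) := ent_eq_ent hμ (by grind)
  have h5 : ent μ (fun ω => (ω.2.2.2.1, ω.1)) = ent μ (fun ω => (ω.1, ω.2.2.2.1)) :=
    ent_eq_ent hμ (by grind)
  have h6 : ent μ (fun ω => (ω.2.2.2.1, ω.1, ω.2.1)) = ent μ (fun ω => (ω.2.1, ω.2.2.2.1, ω.1)) :=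
    ent_eq_ent hμ (by grind)
  have h7 : ent μ (fun ω => (ω.1, ω.2.1)) = ent μ (fun ω => (ω.2.1, ω.1)) :=
    ent_eq_ent hμ (by grind)
  have h8 : ent μ (fun ω => (ω.2.2.2.1, ω.2.1)) = ent μ (fun ω => (ω.2.1, ω.2.2.2.1)) :=
    ent_eq_ent hμ (by grind)
  linarith

/-- The key-independent channel to `(V, Y)` in which `V` is `Y` relabelled by `e`. -/
def relabelledChannel (𝒦 : Type*) (e : 𝒱 ≃ 𝒴) (W : 𝒳 → 𝒴 → ℝ) : 𝒦 → 𝒳 → 𝒱 → 𝒴 → ℝ :=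
  fun _ x v y => if e v = y then W x y else 0

omit [Fintype 𝒳] [DecidableEq 𝒳] [Fintype 𝒦] [DecidableEq 𝒦] [DecidableEq 𝒱] in
theorem sum_relabelledChannel (e : 𝒱 ≃ 𝒴) (W : 𝒳 → 𝒴 → ℝ) (k : 𝒦) (x : 𝒳) (y : 𝒴) :
    ∑ v, relabelledChannel 𝒦 e W k x v y = W x y := by
  simp only [relabelledChannel]
  rw [Equiv.sum_comp e fun y' => if y' = y then W x y else 0]
  simp

omit [Fintype 𝒳] [DecidableEq 𝒳] [Fintype 𝒦] [DecidableEq 𝒦] [Fintype 𝒱] [DecidableEq 𝒱] in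
theorem relabelledChannel_nonneg (e : 𝒱 ≃ 𝒴) {W : 𝒳 → 𝒴 → ℝ} (hW : IsChannel W)
    (k : 𝒦) (x : 𝒳) (v : 𝒱) (y : 𝒴) : 0 ≤ relabelledChannel 𝒦 e W k x v y := by
  simp only [relabelledChannel]
  split_ifs <;> simp [hW.1]

omit [Fintype 𝒳] [DecidableEq 𝒳] [Fintype 𝒦] [DecidableEq 𝒦] [DecidableEq 𝒱] in
theorem sum_sum_relabelledChannel (e : 𝒱 ≃ 𝒴) {W : 𝒳 → 𝒴 → ℝ} (hW : IsChannel W)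
    (k : 𝒦) (x : 𝒳) : ∑ v, ∑ y, relabelledChannel 𝒦 e W k x v y = 1 := by
  rw [Finset.sum_comm]
  simp only [sum_relabelledChannel, hW.2]

omit [Fintype 𝒳] [DecidableEq 𝒳] [DecidableEq 𝒦] [DecidableEq 𝒱] in
theorem averagedChannel_relabelledChannel (hpK : IsPMF pK) (e : 𝒱 ≃ 𝒴) (W : 𝒳 → 𝒴 → ℝ) :
    averagedChannel pK (relabelledChannel 𝒦 e W) = W := by
  funext x y
  simp only [averagedChannel, sum_relabelledChannel, ← Finset.sum_mul, hpK.2, one_mul]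

omit [Fintype 𝒳] [DecidableEq 𝒳] [Fintype 𝒦] [DecidableEq 𝒦] [Fintype 𝒱] [DecidableEq 𝒱]
  [Fintype 𝒴] in
theorem eq_of_jointAF_relabelledChannel_ne_zero {e : 𝒱 ≃ 𝒴} {W : 𝒳 → 𝒴 → ℝ}
    {ω : 𝒦 × 𝒳 × 𝒱 × 𝒴 × 𝒴} (h : jointAF pK pX (relabelledChannel 𝒦 e W) ω ≠ 0) :
    e ω.2.2.1 = ω.2.2.2.1 := by
  by_contra h0
  simp [jointAF, relabelledChannel, h0] at h

omit [DecidableEq 𝒱] in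
theorem indepRV_relabelledChannel (hpK : IsPMF pK) (hpX : IsPMF pX) (e : 𝒱 ≃ 𝒴)
    {W : 𝒳 → 𝒴 → ℝ} (hW : IsChannel W) :
    IndepRV (jointAF pK pX (relabelledChannel 𝒦 e W)) (fun ω => ω.1)
      (fun ω => (ω.2.1, ω.2.2.2.1)) := by
  rintro k ⟨x, y⟩
  rw [prEq_jointAF, prEq_jointAF_key hpX (sum_sum_relabelledChannel e hW), ← jm_averagedChannel,
    averagedChannel_relabelledChannel hpK, sum_relabelledChannel, jm, mul_assoc]

/-- Choosing `V` as a relabelling of `Y`, with `(V, Y)` independent of `K`, attains equality in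
`H(K|Y) ≤ H(K)`, `I(V;Z|K) − I(V;X|K) ≤ H(Y|X)` and `I(X;Y) ≤ I(X;Y,V|K) + I(K;Y)`. -/
theorem relabelledChannel_equalities (hpK : IsPMF pK) (hpX : IsPMF pX) (e : 𝒱 ≃ 𝒴)
    {W : 𝒳 → 𝒴 → ℝ} (hW : IsChannel W) :
    condEnt (jointAF pK pX (relabelledChannel 𝒦 e W)) (fun ω => ω.1) (fun ω => ω.2.2.2.1)
        = entPMF pK ∧
      condMutInf (jointAF pK pX (relabelledChannel 𝒦 e W))
          (fun ω => ω.2.2.1) (fun ω => ω.2.2.2.2) (fun ω => ω.1)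
        - condMutInf (jointAF pK pX (relabelledChannel 𝒦 e W))
          (fun ω => ω.2.2.1) (fun ω => ω.2.1) (fun ω => ω.1)
        = condEnt (jm pX W) Prod.snd Prod.fst ∧
      condMutInf (jointAF pK pX (relabelledChannel 𝒦 e W))
          (fun ω => ω.2.1) (fun ω => (ω.2.2.2.1, ω.2.2.1)) (fun ω => ω.1)
        + mutInf (jointAF pK pX (relabelledChannel 𝒦 e W))
          (fun ω => ω.1) (fun ω => ω.2.2.2.1)
        = mutInf (jm pX W) Prod.fst Prod.snd := by
  have hpmf := isPMF_jointAF hpK hpX (relabelledChannel_nonneg (𝒦 := 𝒦) e hW)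
    (sum_sum_relabelledChannel e hW)
  have hkey := ent_jointAF_key (pK := pK) hpX (sum_sum_relabelledChannel (𝒦 := 𝒦) e hW)
  have hind := ent_pair_of_indepRV hpmf (indepRV_relabelledChannel hpK hpX e hW)
  have hjm := jm_averagedChannel (pK := pK) (pX := pX) (relabelledChannel 𝒦 e W)
  rw [averagedChannel_relabelledChannel hpK] at hjm
  have hsupp : ∀ ω, jointAF pK pX (relabelledChannel 𝒦 e W) ω ≠ 0 →
      ω.2.2.1 = e.symm ω.2.2.2.1 ∧ ω.2.2.2.2 = ω.2.2.2.1 := fun ω h =>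
    ⟨e.eq_symm_apply.2 (eq_of_jointAF_relabelledChannel_ne_zero h), eq_of_jointAF_ne_zero h⟩
  rw [hjm]
  simp only [condMutInf, condEnt, mutInf, ent_prEq]
  set μ := jointAF pK pX (relabelledChannel 𝒦 e W)
  have hμ := hpmf.1
  have hKX : ent μ (fun ω => (ω.1, ω.2.1)) = ent μ (fun ω => ω.1) + ent μ (fun ω => ω.2.1) := by
    have h1 := ent_submodular hμ (fun ω => ω.1) (fun ω => ω.2.2.2.1) (fun ω => ω.2.1)
    have h2 := ent_pair_le hpmf (fun ω => ω.1) (fun ω => ω.2.1)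
    have h3 : ent μ (fun ω => (ω.1, ω.2.2.2.1, ω.2.1)) =
        ent μ (fun ω => (ω.1, ω.2.1, ω.2.2.2.1)) := ent_eq_ent hμ (by grind)
    have h4 : ent μ (fun ω => (ω.2.2.2.1, ω.2.1)) = ent μ (fun ω => (ω.2.1, ω.2.2.2.1)) :=
      ent_eq_ent hμ (by grind)
    linarith
  have hKY : ent μ (fun ω => (ω.1, ω.2.2.2.1)) =
      ent μ (fun ω => ω.1) + ent μ (fun ω => ω.2.2.2.1) := by
    have h1 := ent_submodular hμ (fun ω => ω.1) (fun ω => ω.2.1) (fun ω => ω.2.2.2.1)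
    have h2 := ent_pair_le hpmf (fun ω => ω.1) (fun ω => ω.2.2.2.1)
    linarith
  have hXK : ent μ (fun ω => (ω.2.1, ω.1)) = ent μ (fun ω => (ω.1, ω.2.1)) :=
    ent_eq_ent hμ (by grind)
  have hYX : ent μ (fun ω => (ω.2.2.2.1, ω.2.1)) = ent μ (fun ω => (ω.2.1, ω.2.2.2.1)) :=
    ent_eq_ent hμ (by grind)
  have hVXK : ent μ (fun ω => (ω.2.2.1, ω.2.1, ω.1)) =
      ent μ (fun ω => (ω.1, ω.2.1, ω.2.2.2.1)) := ent_eq_ent hμ fun ω ω' h h' => by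
    rw [(hsupp ω h).1, (hsupp ω' h').1]
    simp only [Prod.mk.injEq, e.symm.apply_eq_iff_eq]
    tauto
  have hVZK : ent μ (fun ω => (ω.2.2.1, ω.2.2.2.2, ω.1)) =
      ent μ (fun ω => (ω.1, ω.2.2.2.1)) := ent_eq_ent hμ fun ω ω' h h' => by
    rw [(hsupp ω h).1, (hsupp ω' h').1, (hsupp ω h).2, (hsupp ω' h').2]
    simp only [Prod.mk.injEq, e.symm.apply_eq_iff_eq]
    tauto
  have hZK : ent μ (fun ω => (ω.2.2.2.2, ω.1)) =
      ent μ (fun ω => (ω.1, ω.2.2.2.1)) := ent_eq_ent hμ fun ω ω' h h' => by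
    rw [(hsupp ω h).2, (hsupp ω' h').2]
    simp only [Prod.mk.injEq]
    tauto
  have hXYVK : ent μ (fun ω => (ω.2.1, (ω.2.2.2.1, ω.2.2.1), ω.1)) =
      ent μ (fun ω => (ω.1, ω.2.1, ω.2.2.2.1)) := ent_eq_ent hμ fun ω ω' h h' => by
    rw [(hsupp ω h).1, (hsupp ω' h').1]
    simp only [Prod.mk.injEq, e.symm.apply_eq_iff_eq]
    tauto
  have hYVK : ent μ (fun ω => ((ω.2.2.2.1, ω.2.2.1), ω.1)) =
      ent μ (fun ω => (ω.1, ω.2.2.2.1)) := ent_eq_ent hμ fun ω ω' h h' => by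
    rw [(hsupp ω h).1, (hsupp ω' h').1]
    simp only [Prod.mk.injEq, e.symm.apply_eq_iff_eq]
    tauto
  refine ⟨?_, ?_, ?_⟩ <;> linarith

end AttackFree

section Statement19

variable {𝒰 𝒰h 𝒳 𝒦 𝒴 : Type*}
  [Fintype 𝒰] [DecidableEq 𝒰] [Fintype 𝒰h] [DecidableEq 𝒰h]
  [Fintype 𝒳] [DecidableEq 𝒳] [Fintype 𝒦] [DecidableEq 𝒦]
  [Fintype 𝒴] [DecidableEq 𝒴]

/-- in the attack-free case the achievable region of Theorem 3 coincides
with that of Theorem 2; moreover, choosing `V = Y` with `(V, Y)` independent of `K`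
simultaneously turns the inequalities `H(K|Y) ≤ H(K)`,
`I(V;Y|K) − I(V;X|K) ≤ H(Y|X)` and `I(X;Y,V|K) + I(K;Y) ≥ I(X;Y)` into equalities. -/
theorem statement19 (pU : 𝒰 → ℝ) (pK : 𝒦 → ℝ) (pX : 𝒳 → ℝ)
    (hpU : IsPMF pU) (hpK : IsPMF pK) (hpX : IsPMF pX)
    (d : 𝒳 → 𝒴 → ℝ) (hd : ∀ x y, 0 ≤ d x y)
    (d' : 𝒰 → 𝒰h → ℝ) (hd' : ∀ u uh, 0 ≤ d' u uh)
    (lam : ℝ) (hlam : 0 < lam)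
    (D D' Rc h h' : ℝ)
    (hKU : entPMF pK ≤ lam * RU pU d' D') :
    (Thm3CondsAF pU pK pX d d' lam D D' Rc h h' ↔
      Thm2Conds pU pK pX d d' lam D D' Rc h h') ∧
    (∀ W : 𝒳 → 𝒴 → ℝ, IsChannel W →
      -- with V = Y, (V, Y) independent of K:
      condEnt (jointAF pK pX (fun _ x (v : 𝒴) y => if v = y then W x y else 0))
          (fun ω => ω.1) (fun ω => ω.2.2.2.1) = entPMF pK ∧
      condMutInf (jointAF pK pX (fun _ x (v : 𝒴) y => if v = y then W x y else 0))
          (fun ω => ω.2.2.1) (fun ω => ω.2.2.2.2) (fun ω => ω.1)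
        - condMutInf (jointAF pK pX (fun _ x (v : 𝒴) y => if v = y then W x y else 0))
          (fun ω => ω.2.2.1) (fun ω => ω.2.1) (fun ω => ω.1)
        = condEnt (jm pX W) Prod.snd Prod.fst ∧
      condMutInf (jointAF pK pX (fun _ x (v : 𝒴) y => if v = y then W x y else 0))
          (fun ω => ω.2.1) (fun ω => (ω.2.2.2.1, ω.2.2.1)) (fun ω => ω.1)
        + mutInf (jointAF pK pX (fun _ x (v : 𝒴) y => if v = y then W x y else 0))
          (fun ω => ω.1) (fun ω => ω.2.2.2.1)
        = mutInf (jm pX W) Prod.fst Prod.snd) := by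
  refine ⟨⟨?_, ?_⟩, fun W hW => relabelledChannel_equalities hpK hpX (Equiv.refl 𝒴) hW⟩
  · rintro ⟨m, -, W, hW, hW1, ha, hb, hc, hdR, he⟩
    have hK := div_le_div_of_nonneg_right (condEnt_key_le hpK hpX hW hW1) hlam.le
    refine ⟨by linarith, by linarith, averagedChannel pK W,
      isChannel_averagedChannel hpK hW hW1,
      hc.trans (condMutInf_sub_condMutInf_le hpK hpX hW hW1), ?_, ?_⟩
    · have := mutInf_le_condMutInf_add_mutInf hpK hpX hW hW1
      linarith
    · rw [jm_averagedChannel, expDist_prEq_pair]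
      exact he
  · rintro ⟨ha, hb, W, hW, hc, hR, hD⟩
    let e : Fin (Fintype.card 𝒴) ≃ 𝒴 := (Fintype.equivFin 𝒴).symm
    obtain ⟨h1, h2, h3⟩ := relabelledChannel_equalities hpK hpX e hW
    have hjm := jm_averagedChannel (pK := pK) (pX := pX) (relabelledChannel 𝒦 e W)
    rw [averagedChannel_relabelledChannel hpK] at hjm
    refine ⟨Fintype.card 𝒴, ?_, relabelledChannel 𝒦 e W, relabelledChannel_nonneg e hW,
      sum_sum_relabelledChannel e hW, ?_, ?_, ?_, ?_, ?_⟩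
    · exact (Nat.le_mul_of_pos_left _ (Nat.mul_pos hpK.card_pos hpX.card_pos)).trans
        (Nat.le_succ _)
    · rwa [h1]
    · rwa [h1]
    · rwa [h2]
    · rw [add_assoc, h3]
      exact hR
    · rw [hjm, expDist_prEq_pair] at hD
      exact hD

end Statement19

end
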